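/- There is an absolute constant K such that for every real A ≥ 1, ∫₀^∞ ∫₀^∞ ((e^{−s} − e^{−t})/(s − t)) · ((e^{−As} − e^{−At})/(s − t)) · (s + t)/√(st) ds dt ≤ K·A^{−1/2}·(1 + log A). -/

import Mathlib

open MeasureTheory ProbabilityTheory Filter Topology

noncomputable section

/-- The integrand `((e^{−s} − e^{−t})/(s − t))·((e^{−As} − e^{−At})/(s − t))·(s + t)/√(st)`
(interpreted as `0` on the measure-zero diagonal `s = t`, by division-by-zero conventions). -/
def limitKernel (A s t : ℝ) : ℝ :=
  ((Real.exp (-s) - Real.exp (-t)) / (s - t)) *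
    ((Real.exp (-(A * s)) - Real.exp (-(A * t))) / (s - t)) *
    ((s + t) / Real.sqrt (s * t))

/-- An even integrable majorant of the dependence of `limitKernel` on `s - t`. -/
def diffMajorant (u : ℝ) : ℝ := min 1 (1 / |u|) / Real.sqrt |u|

/-- The majorant of the dependence of `limitKernel` on `min s t`. -/
def minMajorant (A s : ℝ) : ℝ := 2 * Real.exp (-(A * s)) * (Real.sqrt A + 1 / Real.sqrt s)

lemma measurable_diffMajorant : Measurable diffMajorant := by
  unfold diffMajorant; fun_prop

lemma measurable_minMajorant (A : ℝ) : Measurable (minMajorant A) := by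
  unfold minMajorant; fun_prop

lemma diffMajorant_nonneg (u : ℝ) : 0 ≤ diffMajorant u := by
  unfold diffMajorant; positivity

lemma diffMajorant_sub_comm (s t : ℝ) : diffMajorant (s - t) = diffMajorant (t - s) := by
  simp only [diffMajorant, abs_sub_comm]

lemma minMajorant_nonneg (A s : ℝ) : 0 ≤ minMajorant A s := by
  unfold minMajorant; positivity

lemma integrable_diffMajorant : Integrable diffMajorant := by
  have h : IntegrableOn (fun u : ℝ => min 1 (1 / u) / Real.sqrt u) (Set.Ioi 0) := by
    have hm : Measurable (fun u : ℝ => min 1 (1 / u) / Real.sqrt u) := by fun_prop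
    rw [← Set.Ioc_union_Ioi_eq_Ioi zero_le_one]
    refine IntegrableOn.union ?_ ?_
    · have h₁ : IntegrableOn (fun u : ℝ => u ^ (-(1 / 2) : ℝ)) (Set.Ioc 0 1) :=
        (intervalIntegrable_iff_integrableOn_Ioc_of_le zero_le_one).1
          (intervalIntegral.intervalIntegrable_rpow' (by norm_num))
      refine Integrable.mono' h₁ hm.aestronglyMeasurable ?_
      refine (ae_restrict_iff' measurableSet_Ioc).2 (ae_of_all _ fun u hu => ?_)
      have hu0 : 0 < u := hu.1
      rw [Real.norm_of_nonneg (by positivity), Real.rpow_neg hu0.le, ← Real.sqrt_eq_rpow,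
        ← one_div]
      gcongr
      exact min_le_left _ _
    · have h₁ : IntegrableOn (fun u : ℝ => u ^ (-(3 / 2) : ℝ)) (Set.Ioi 1) :=
        integrableOn_Ioi_rpow_of_lt (by norm_num) zero_lt_one
      refine Integrable.mono' h₁ hm.aestronglyMeasurable ?_
      refine (ae_restrict_iff' measurableSet_Ioi).2 (ae_of_all _ fun u hu => ?_)
      have hu0 : 0 < u := zero_lt_one.trans hu
      have e : u ^ (-(3 / 2) : ℝ) = 1 / u / Real.sqrt u := by
        rw [show (-(3 / 2) : ℝ) = -1 + -(1 / 2) by norm_num, Real.rpow_add hu0,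
          Real.rpow_neg_one, Real.rpow_neg hu0.le, ← Real.sqrt_eq_rpow, one_div, div_eq_mul_inv]
      rw [Real.norm_of_nonneg (by positivity), e]
      gcongr
      exact min_le_right _ _
  have h_pos : IntegrableOn diffMajorant (Set.Ioi 0) :=
    h.congr_fun (fun u hu => by simp only [diffMajorant, abs_of_pos (Set.mem_Ioi.1 hu)])
      measurableSet_Ioi
  have h_neg : IntegrableOn diffMajorant (Set.Iic 0) := by
    have m : MeasurableEmbedding fun u : ℝ => -u := (Homeomorph.neg ℝ).measurableEmbedding
    rw [← Measure.map_neg_eq_self (volume : Measure ℝ), m.integrableOn_map_iff]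
    simp only [Function.comp_def, diffMajorant, abs_neg, Set.neg_preimage, Set.neg_Iic, neg_zero]
    exact Iff.mpr integrableOn_Ici_iff_integrableOn_Ioi h_pos
  rw [← integrableOn_univ, ← Set.Iic_union_Ioi (a := (0 : ℝ))]
  exact h_neg.union h_pos

lemma limitKernel_comm (A s t : ℝ) : limitKernel A s t = limitKernel A t s := by
  unfold limitKernel
  rw [← neg_sub t s, mul_comm s t, add_comm s t, ← neg_sub (Real.exp (-t)),
    ← neg_sub (Real.exp (-(A * t))), neg_div_neg_eq, neg_div_neg_eq]

lemma exp_neg_sub_exp_neg_le {x y : ℝ} : Real.exp (-x) - Real.exp (-y) ≤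
    Real.exp (-x) * (y - x) := by
  have h := Real.add_one_le_exp (x - y)
  have e : Real.exp (-y) = Real.exp (-x) * Real.exp (x - y) := by
    rw [← Real.exp_add]; ring_nf
  rw [e]
  nlinarith [Real.exp_pos (-x)]

lemma add_div_sqrt_mul_le {s t : ℝ} (hs : 0 < s) (hst : s < t) :
    (s + t) / Real.sqrt (s * t) ≤ 2 * (1 + Real.sqrt (t - s) / Real.sqrt s) := by
  have ht : 0 < t := hs.trans hst
  have h : Real.sqrt t ≤ Real.sqrt s + Real.sqrt (t - s) := by
    refine Real.sqrt_le_iff.2 ⟨by positivity, ?_⟩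
    nlinarith [Real.sq_sqrt hs.le, Real.sq_sqrt (sub_nonneg.2 hst.le), Real.sqrt_nonneg s,
      Real.sqrt_nonneg (t - s), mul_nonneg (Real.sqrt_nonneg s) (Real.sqrt_nonneg (t - s))]
  have hs' := Real.sqrt_pos.2 hs
  have ht' := Real.sqrt_pos.2 ht
  calc (s + t) / Real.sqrt (s * t) ≤ (2 * t) / (Real.sqrt s * Real.sqrt t) := by
        rw [Real.sqrt_mul hs.le]; gcongr; linarith
    _ = 2 * (Real.sqrt t / Real.sqrt s) := by
        field_simp; rw [Real.sq_sqrt ht.le]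
    _ ≤ 2 * ((Real.sqrt s + Real.sqrt (t - s)) / Real.sqrt s) := by gcongr
    _ = _ := by field_simp

lemma limitKernel_le_of_lt {A s t : ℝ} (hA : 0 < A) (hs : 0 < s) (hst : s < t) :
    limitKernel A s t ≤ minMajorant A s * diffMajorant (t - s) := by
  have hu : 0 < t - s := sub_pos.2 hst
  have ht : 0 < t := hs.trans hst
  have hw := add_div_sqrt_mul_le hs hst
  have hsq : 0 < Real.sqrt (t - s) := Real.sqrt_pos.2 hu
  set p := (Real.exp (-s) - Real.exp (-t)) / (t - s) with hp
  set q := (Real.exp (-(A * s)) - Real.exp (-(A * t))) / (t - s) with hq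
  set E := Real.exp (-(A * s))
  have hE0 : 0 < E := Real.exp_pos _
  have hp0 : 0 ≤ p := div_nonneg (sub_nonneg.2 (Real.exp_le_exp.2 (by linarith))) hu.le
  have hq0 : 0 ≤ q := div_nonneg (sub_nonneg.2 (Real.exp_le_exp.2 (by nlinarith))) hu.le
  have hes : Real.exp (-s) ≤ 1 := Real.exp_le_one_iff.2 (by linarith)
  have hp1 : p ≤ min 1 (1 / (t - s)) := by
    refine le_min ?_ ?_
    · rw [hp, div_le_one hu]
      exact exp_neg_sub_exp_neg_le.trans (by nlinarith)
    · rw [hp]; gcongr; linarith [Real.exp_pos (-t)]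
  have hqA : q ≤ E * A := by
    rw [hq, div_le_iff₀ hu]
    exact exp_neg_sub_exp_neg_le.trans_eq (by ring)
  have hqu : q ≤ E / (t - s) := by
    rw [hq]; gcongr; linarith [Real.exp_pos (-(A * t))]
  have hu2 : Real.sqrt (t - s) ^ 2 = t - s := Real.sq_sqrt hu.le
  have hq1 : q * Real.sqrt (t - s) ≤ E * Real.sqrt A := by
    refine le_of_sq_le_sq ?_ (by positivity)
    rw [mul_pow, mul_pow, hu2, Real.sq_sqrt hA.le]
    have := (le_div_iff₀ hu).1 hqu
    calc q ^ 2 * (t - s) = q * (q * (t - s)) := by ring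
      _ ≤ (E * A) * E := by gcongr
      _ = _ := by ring
  have key : q * ((s + t) / Real.sqrt (s * t)) * Real.sqrt (t - s) ≤ minMajorant A s := by
    calc q * ((s + t) / Real.sqrt (s * t)) * Real.sqrt (t - s)
        ≤ q * (2 * (1 + Real.sqrt (t - s) / Real.sqrt s)) * Real.sqrt (t - s) := by gcongr
      _ = 2 * (q * Real.sqrt (t - s) + q * Real.sqrt (t - s) ^ 2 / Real.sqrt s) := by ring
      _ ≤ 2 * (E * Real.sqrt A + E / Real.sqrt s) := by
        rw [hu2]; gcongr; exact (le_div_iff₀ hu).1 hqu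
      _ = minMajorant A s := by rw [minMajorant]; ring
  have hk : limitKernel A s t = p * (q * ((s + t) / Real.sqrt (s * t))) := by
    rw [limitKernel, ← neg_sub t s, div_neg, div_neg, hp, hq]; ring
  have hd : minMajorant A s * diffMajorant (t - s) =
      min 1 (1 / (t - s)) * minMajorant A s / Real.sqrt (t - s) := by
    rw [diffMajorant, abs_of_pos hu]; ring
  rw [hk, hd, le_div_iff₀ hsq, mul_assoc]
  exact mul_le_mul hp1 key (by positivity) (by positivity)

lemma limitKernel_le {A s t : ℝ} (hA : 0 < A) (hs : 0 < s) (ht : 0 < t) :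
    limitKernel A s t ≤
      minMajorant A s * diffMajorant (t - s) + minMajorant A t * diffMajorant (t - s) := by
  have h₁ := mul_nonneg (minMajorant_nonneg A s) (diffMajorant_nonneg (t - s))
  have h₂ := mul_nonneg (minMajorant_nonneg A t) (diffMajorant_nonneg (t - s))
  rcases lt_trichotomy s t with h | h | h
  · linarith [limitKernel_le_of_lt hA hs h]
  · have : limitKernel A s t = 0 := by simp [limitKernel, h]
    linarith
  · have := limitKernel_le_of_lt hA ht h
    rw [limitKernel_comm, diffMajorant_sub_comm] at this
    linarith

lemma lintegral_minMajorant {A : ℝ} (hA : 0 < A) :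
    ∫⁻ s in Set.Ioi (0 : ℝ), ENNReal.ofReal (minMajorant A s) =
      ENNReal.ofReal (2 * (1 + Real.sqrt Real.pi) * A ^ (-(1 / 2) : ℝ)) := by
  have i₁ : IntegrableOn (fun s : ℝ => Real.exp (-A * s)) (Set.Ioi 0) :=
    exp_neg_integrableOn_Ioi 0 hA
  have v₁ : ∫ s in Set.Ioi (0 : ℝ), Real.exp (-A * s) = 1 / A := by
    simpa [neg_div_neg_eq] using integral_exp_mul_Ioi (neg_neg_of_pos hA) 0
  have v₂ : ∫ s in Set.Ioi (0 : ℝ), s ^ ((1 / 2 : ℝ) - 1) * Real.exp (-(A * s)) =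
      (1 / A) ^ (1 / 2 : ℝ) * Real.sqrt Real.pi := by
    rw [Real.integral_rpow_mul_exp_neg_mul_Ioi (by norm_num) hA, Real.Gamma_one_half_eq]
  have i₂ : IntegrableOn (fun s : ℝ => s ^ ((1 / 2 : ℝ) - 1) * Real.exp (-(A * s)))
      (Set.Ioi 0) := by
    refine Integrable.of_integral_ne_zero ?_
    rw [v₂]
    positivity
  have e : Set.EqOn (minMajorant A) (fun s => 2 * Real.sqrt A * Real.exp (-A * s) +
      2 * (s ^ ((1 / 2 : ℝ) - 1) * Real.exp (-(A * s)))) (Set.Ioi 0) := by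
    intro s hs
    have hs0 : 0 < s := hs
    simp only [minMajorant]
    rw [show (1 / 2 : ℝ) - 1 = -(1 / 2) by norm_num, Real.rpow_neg hs0.le, ← Real.sqrt_eq_rpow,
      neg_mul]
    ring
  have j₁ := i₁.const_mul (2 * Real.sqrt A)
  have j₂ := i₂.const_mul 2
  have hi : IntegrableOn (minMajorant A) (Set.Ioi 0) :=
    (integrableOn_congr_fun e measurableSet_Ioi).2 (j₁.add j₂)
  rw [← ofReal_integral_eq_lintegral_ofReal hi (ae_of_all _ (minMajorant_nonneg A)),
    setIntegral_congr_fun measurableSet_Ioi e, integral_add j₁ j₂, integral_const_mul,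
    integral_const_mul, v₁, v₂, Real.rpow_neg hA.le, one_div A, Real.inv_rpow hA.le,
    ← Real.sqrt_eq_rpow]
  congr 1
  have := Real.sqrt_pos.2 hA
  have h2 := Real.sq_sqrt hA.le
  field_simp
  rw [h2]
  ring

/-- Lemma 6.6 of the paper: there is an absolute constant `K` such that for every `A ≥ 1`,
`∫₀^∞ ∫₀^∞ ((e^{−s} − e^{−t})/(s − t)) ((e^{−As} − e^{−At})/(s − t)) (s + t)/√(st) ds dt ≤
K A^{−1/2} (1 + log A)`.  (The integrand is nonnegative, so we state this using the lower
Lebesgue integral, which also asserts finiteness of the integral.) -/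
theorem limit_integral_bound :
    ∃ K : ℝ, ∀ A : ℝ, 1 ≤ A →
      (∫⁻ s in Set.Ioi (0 : ℝ), ∫⁻ t in Set.Ioi (0 : ℝ),
          ENNReal.ofReal (limitKernel A s t))
        ≤ ENNReal.ofReal (K * A ^ (-(1 / 2) : ℝ) * (1 + Real.log A)) := by
  set C : ℝ := ∫ u, diffMajorant u
  have hC : ∫⁻ u, ENNReal.ofReal (diffMajorant u) = ENNReal.ofReal C :=
    (ofReal_integral_eq_lintegral_ofReal integrable_diffMajorant
      (ae_of_all _ diffMajorant_nonneg)).symm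
  have hC0 : 0 ≤ C := integral_nonneg diffMajorant_nonneg
  refine ⟨4 * (1 + Real.sqrt Real.pi) * C, fun A hA => ?_⟩
  have hA0 : 0 < A := zero_lt_one.trans_le hA
  have hM := measurable_minMajorant A
  have hD := measurable_diffMajorant
  obtain ⟨F, hFst⟩ : ∃ F : ℝ → ℝ → ENNReal, ∀ s t, F s t =
      ENNReal.ofReal (minMajorant A s) * ENNReal.ofReal (diffMajorant (t - s)) :=
    ⟨_, fun _ _ => rfl⟩
  have hF : Measurable (Function.uncurry F) := by
    simp only [Function.uncurry_def, hFst]; fun_prop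
  have hG : Measurable (Function.uncurry fun s t => F t s) := hF.comp measurable_swap
  have hFG : ∀ s ∈ Set.Ioi (0 : ℝ), ∀ t ∈ Set.Ioi (0 : ℝ),
      ENNReal.ofReal (limitKernel A s t) ≤ F s t + F t s := by
    intro s hs t ht
    rw [hFst, hFst, diffMajorant_sub_comm s t, ← ENNReal.ofReal_mul (minMajorant_nonneg A s),
      ← ENNReal.ofReal_mul (minMajorant_nonneg A t), ← ENNReal.ofReal_add
      (mul_nonneg (minMajorant_nonneg A s) (diffMajorant_nonneg _))
      (mul_nonneg (minMajorant_nonneg A t) (diffMajorant_nonneg _))]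
    exact ENNReal.ofReal_le_ofReal (limitKernel_le hA0 hs ht)
  have hIF : ∫⁻ s in Set.Ioi (0 : ℝ), ∫⁻ t in Set.Ioi (0 : ℝ), F s t ≤
      ENNReal.ofReal (2 * (1 + Real.sqrt Real.pi) * A ^ (-(1 / 2) : ℝ)) * ENNReal.ofReal C := by
    calc ∫⁻ s in Set.Ioi (0 : ℝ), ∫⁻ t in Set.Ioi (0 : ℝ), F s t
        ≤ ∫⁻ s in Set.Ioi (0 : ℝ), ∫⁻ t, F s t :=
          lintegral_mono fun s => setLIntegral_le_lintegral _ _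
      _ = ∫⁻ s in Set.Ioi (0 : ℝ), ENNReal.ofReal (minMajorant A s) * ENNReal.ofReal C := by
          refine lintegral_congr fun s => ?_
          simp only [hFst]
          rw [lintegral_const_mul _ (by fun_prop),
            lintegral_sub_right_eq_self (fun u => ENNReal.ofReal (diffMajorant u)) s, hC]
      _ = _ := by rw [lintegral_mul_const _ (by fun_prop), lintegral_minMajorant hA0]
  have hIG : ∫⁻ s in Set.Ioi (0 : ℝ), ∫⁻ t in Set.Ioi (0 : ℝ), F t s =
      ∫⁻ s in Set.Ioi (0 : ℝ), ∫⁻ t in Set.Ioi (0 : ℝ), F s t :=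
    lintegral_lintegral_swap hG.aemeasurable
  calc ∫⁻ s in Set.Ioi (0 : ℝ), ∫⁻ t in Set.Ioi (0 : ℝ), ENNReal.ofReal (limitKernel A s t)
      ≤ ∫⁻ s in Set.Ioi (0 : ℝ), ∫⁻ t in Set.Ioi (0 : ℝ), (F s t + F t s) :=
        setLIntegral_mono' measurableSet_Ioi fun s hs =>
          setLIntegral_mono' measurableSet_Ioi fun t ht => hFG s hs t ht
    _ = ∫⁻ s in Set.Ioi (0 : ℝ), ((∫⁻ t in Set.Ioi (0 : ℝ), F s t) +
          ∫⁻ t in Set.Ioi (0 : ℝ), F t s) :=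
        lintegral_congr fun s => lintegral_add_left (hF.comp measurable_prodMk_left) _
    _ = (∫⁻ s in Set.Ioi (0 : ℝ), ∫⁻ t in Set.Ioi (0 : ℝ), F s t) +
          ∫⁻ s in Set.Ioi (0 : ℝ), ∫⁻ t in Set.Ioi (0 : ℝ), F t s :=
        lintegral_add_left hF.lintegral_prod_right' _
    _ ≤ ENNReal.ofReal (2 * (1 + Real.sqrt Real.pi) * A ^ (-(1 / 2) : ℝ)) * ENNReal.ofReal C +
          ENNReal.ofReal (2 * (1 + Real.sqrt Real.pi) * A ^ (-(1 / 2) : ℝ)) *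
            ENNReal.ofReal C := by
        rw [hIG]; gcongr
    _ = ENNReal.ofReal (4 * (1 + Real.sqrt Real.pi) * C * A ^ (-(1 / 2) : ℝ)) := by
        rw [← ENNReal.ofReal_mul (by positivity), ← ENNReal.ofReal_add (by positivity)
          (by positivity)]
        ring_nf
    _ ≤ ENNReal.ofReal (4 * (1 + Real.sqrt Real.pi) * C * A ^ (-(1 / 2) : ℝ) *
          (1 + Real.log A)) :=
        ENNReal.ofReal_le_ofReal (le_mul_of_one_le_right (by positivity)
          (by linarith [Real.log_nonneg hA]))
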